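/- Let V be a finitely generated free ℤ-module with dual V* = Hom_ℤ(V, ℤ), let d be a nonzero integer, and let m : V → V* be a ℤ-linear map whose polarization has symmetric mod d reduction, i.e. m(x)(y) ≡ m(y)(x) (mod d) for all x, y ∈ V. For c ∈ V*, the subset c(ker(ρ_d m)) := {c(y) mod d : y ∈ ker(ρ_d m)} of ℤ/dℤ is a subgroup depending only on the class c̄ of c in coker(ρ_d m), and its cardinality equals the additive order of c̄ in coker(ρ_d m); equivalently, the index [ℤ/dℤ : c(ker(ρ_d m))] equals |d| divided by the additive order of c̄. -/

import Mathlib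

/-- The submodule `d V* + im m` of `V* = Hom_ℤ(V, ℤ)`, so that
`V* ⧸ (d V* + im m)` is the cokernel of the mod-`d` reduction `ρ_d m` of `m`. -/
def dPlusRange (V : Type*) [AddCommGroup V] [Module ℤ V] (d : ℤ)
    (m : V →ₗ[ℤ] (V →ₗ[ℤ] ℤ)) : Submodule ℤ (V →ₗ[ℤ] ℤ) :=
  LinearMap.range (d • (LinearMap.id : (V →ₗ[ℤ] ℤ) →ₗ[ℤ] (V →ₗ[ℤ] ℤ))) ⊔
    LinearMap.range m

section

variable {V : Type*} [AddCommGroup V] [Module ℤ V]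

/-- If `N` contains `d • M`, then an element of `M` lies in `N` as soon as every linear form that is
divisible by `d` on `N` is divisible by `d` at that element. -/
theorem Submodule.mem_of_forall_dual_dvd {R M : Type*} [CommRing R] [IsDomain R]
    [IsPrincipalIdealRing R] [AddCommGroup M] [Module R M]
    [Module.Free R M] [Module.Finite R M] {d : R} (hd : d ≠ 0) (N : Submodule R M)
    (hN : ∀ x : M, d • x ∈ N) (f : M)
    (hf : ∀ φ : M →ₗ[R] R, (∀ x ∈ N, d ∣ φ x) → d ∣ φ f) : f ∈ N := by
  obtain ⟨n, S⟩ := N.smithNormalForm (Module.Free.chooseBasis R M)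
  rw [← S.bM.sum_repr f]
  refine N.sum_mem fun j _ => ?_
  have hj : j ∈ Set.range S.f := by
    by_contra h
    have h0 := S.repr_eq_zero_of_notMem_range ⟨_, hN (S.bM j)⟩ h
    simp [hd] at h0
  obtain ⟨i, rfl⟩ := hj
  have hcoord : ∀ x ∈ N, S.a i ∣ S.bM.repr x (S.f i) := fun x hx => by
    have h := S.repr_apply_embedding_eq_repr_smul ⟨x, hx⟩ (i := i)
    simp only [map_smul, Finsupp.smul_apply, smul_eq_mul] at h
    rw [h]
    simp
  obtain ⟨k, hk⟩ : S.a i ∣ d := by simpa using hcoord _ (hN (S.bM (S.f i)))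
  have hk0 : k ≠ 0 := by rintro rfl; simp [hd] at hk
  have hdvd : d ∣ k * S.bM.repr f (S.f i) := hf (k • S.bM.coord (S.f i)) fun x hx => by
    obtain ⟨e, he⟩ := hcoord x hx
    exact ⟨e, by simp [he, hk]; ring⟩
  rw [hk, mul_comm (S.a i)] at hdvd
  obtain ⟨e, he⟩ := (mul_dvd_mul_iff_left hk0).1 hdvd
  rw [he, mul_comm, mul_smul, ← S.snf]
  exact N.smul_mem _ (S.bN i).2

theorem Module.Dual.exists_eq_smul_of_forall_dvd [Module.Free ℤ V] [Module.Finite ℤ V] {d : ℤ}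
    (f : V →ₗ[ℤ] ℤ) (h : ∀ x, d ∣ f x) : ∃ t : V →ₗ[ℤ] ℤ, f = d • t := by
  choose g hg using h
  let b := Module.Free.chooseBasis ℤ V
  exact ⟨b.constr ℤ fun i => g (b i), b.ext fun i => by simp [hg]⟩

/-- An element of `d V* + im m` is divisible by `d` on the kernel of `ρ_d m`. -/
theorem dvd_apply_of_mem_dPlusRange {d : ℤ} {m : V →ₗ[ℤ] (V →ₗ[ℤ] ℤ)}
    (hsym : ∀ x y : V, d ∣ m x y - m y x) {f : V →ₗ[ℤ] ℤ} (hf : f ∈ dPlusRange V d m)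
    {y : V} (hy : ∃ t : V →ₗ[ℤ] ℤ, m y = d • t) : d ∣ f y := by
  obtain ⟨_, ⟨u, rfl⟩, _, ⟨x, rfl⟩, rfl⟩ := Submodule.mem_sup.1 hf
  obtain ⟨t, ht⟩ := hy
  have h := hsym x y
  rw [ht] at h
  have h' : d ∣ m x y := (dvd_sub_left (by simp)).1 h
  simpa using h'

/-- The submodule `d V* + im m` is the annihilator modulo `d` of the kernel of `ρ_d m`. -/
theorem mem_dPlusRange_iff [Module.Free ℤ V] [Module.Finite ℤ V] {d : ℤ} (hd : d ≠ 0)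
    {m : V →ₗ[ℤ] (V →ₗ[ℤ] ℤ)} (hsym : ∀ x y : V, d ∣ m x y - m y x) (f : V →ₗ[ℤ] ℤ) :
    f ∈ dPlusRange V d m ↔ ∀ y : V, (∃ t : V →ₗ[ℤ] ℤ, m y = d • t) → d ∣ f y := by
  refine ⟨fun hf y hy => dvd_apply_of_mem_dPlusRange hsym hf hy, fun h => ?_⟩
  refine Submodule.mem_of_forall_dual_dvd hd _
    (fun x => Submodule.mem_sup_left (LinearMap.mem_range.2 ⟨x, by simp⟩)) f fun φ hφ => ?_
  obtain ⟨y, rfl⟩ := (Module.evalEquiv ℤ V).surjective φ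
  refine h y (Module.Dual.exists_eq_smul_of_forall_dvd _ fun x => ?_)
  have hx : d ∣ m x y := hφ (m x) (Submodule.mem_sup_right ⟨x, rfl⟩)
  exact (dvd_sub_right hx).1 (hsym x y)

end

/-- Let `V` be a finitely generated free ℤ-module with dual
`V* = Hom_ℤ(V, ℤ)`, let `d` be a nonzero integer, and let `m : V → V*` be a
ℤ-linear map whose polarization has symmetric mod `d` reduction.  For `c ∈ V*`,
the subset `c (ker (ρ_d m)) = {c y mod d : m y ∈ d V*} ⊆ ℤ/dℤ` is a subgroup
depending only on the class of `c` in `coker (ρ_d m) = V*/(d V* + im m)`, and its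
cardinality equals the additive order of that class; equivalently its index in
`ℤ/dℤ` equals `|d|` divided by the additive order of that class. -/
theorem stmt3 (V : Type*) [AddCommGroup V] [Module ℤ V]
    [Module.Free ℤ V] [Module.Finite ℤ V]
    (d : ℤ) (hd : d ≠ 0)
    (m : V →ₗ[ℤ] (V →ₗ[ℤ] ℤ))
    (hsym : ∀ x y : V, d ∣ m x y - m y x)
    (c : V →ₗ[ℤ] ℤ) :
    ∃ H : AddSubgroup (ZMod d.natAbs),
      (H : Set (ZMod d.natAbs)) =
        {z | ∃ y : V, (∃ t : V →ₗ[ℤ] ℤ, m y = d • t) ∧ z = ((c y : ℤ) : ZMod d.natAbs)} ∧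
      (∀ c' : V →ₗ[ℤ] ℤ, c - c' ∈ dPlusRange V d m →
        {z | ∃ y : V, (∃ t : V →ₗ[ℤ] ℤ, m y = d • t) ∧ z = ((c' y : ℤ) : ZMod d.natAbs)} =
          (H : Set (ZMod d.natAbs))) ∧
      Nat.card H =
        addOrderOf (Submodule.Quotient.mk c : (V →ₗ[ℤ] ℤ) ⧸ dPlusRange V d m) ∧
      H.index =
        d.natAbs / addOrderOf (Submodule.Quotient.mk c : (V →ₗ[ℤ] ℤ) ⧸ dPlusRange V d m) := by
  let K : AddSubgroup V :=
    ((LinearMap.range (d • (LinearMap.id : (V →ₗ[ℤ] ℤ) →ₗ[ℤ] (V →ₗ[ℤ] ℤ)))).comap m).toAddSubgroup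
  have hK : ∀ y, y ∈ K ↔ ∃ t : V →ₗ[ℤ] ℤ, m y = d • t := fun y =>
    exists_congr fun t => eq_comm
  have hcast : ∀ a : ℤ, (a : ZMod d.natAbs) = 0 ↔ d ∣ a := fun a => by
    rw [ZMod.intCast_zmod_eq_zero_iff_dvd, Int.natAbs_dvd]
  let H : AddSubgroup (ZMod d.natAbs) :=
    K.map ((Int.castAddHom (ZMod d.natAbs)).comp c.toAddMonoidHom)
  have hH : ∀ z, z ∈ H ↔ ∃ y : V, (∃ t : V →ₗ[ℤ] ℤ, m y = d • t) ∧
      z = ((c y : ℤ) : ZMod d.natAbs) := fun z =>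
    exists_congr fun y => and_congr (hK y) eq_comm
  have hcard : Nat.card H =
      addOrderOf (Submodule.Quotient.mk c : (V →ₗ[ℤ] ℤ) ⧸ dPlusRange V d m) := by
    rw [← IsAddCyclic.exponent_eq_card]
    refine Nat.dvd_right_iff_eq.1 fun n => ?_
    rw [AddMonoid.exponent_dvd_iff_forall_nsmul_eq_zero, addOrderOf_dvd_iff_nsmul_eq_zero,
      ← Submodule.Quotient.mk_smul, Submodule.Quotient.mk_eq_zero, mem_dPlusRange_iff hd hsym]
    constructor
    · intro h y hy
      have := congrArg Subtype.val (h ⟨_, (hH _).2 ⟨y, hy, rfl⟩⟩)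
      rw [← hcast]
      simpa using this
    · rintro h ⟨z, hz⟩
      obtain ⟨y, hy, rfl⟩ := (hH z).1 hz
      have := (hcast _).2 (h y hy)
      exact Subtype.ext (by simpa using this)
  refine ⟨H, Set.ext hH, fun c' hc' => Set.ext fun z => ?_, hcard, ?_⟩
  · refine Iff.trans (exists_congr fun y => and_congr_right fun hy => ?_) (hH z).symm
    have h := (hcast _).2 (dvd_apply_of_mem_dPlusRange hsym hc' hy)
    rw [LinearMap.sub_apply, Int.cast_sub, sub_eq_zero] at h
    rw [h]
  · have : NeZero d.natAbs := ⟨Int.natAbs_ne_zero.2 hd⟩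
    rw [← hcard]
    refine (Nat.div_eq_of_eq_mul_right Nat.card_pos ?_).symm
    rw [H.card_mul_index, Nat.card_zmod]
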